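/- Let X be a compact length space of diameter d and let ρ : X̃ → X be an n-fold covering map, where X̃ carries the lifted length metric (i.e., the length of any curve in X̃ equals the length of its projection to X). Then diam(X̃) ≤ n·d. -/

import Mathlib

open Set

/-- A length space: the distance between two points is the infimum of lengths of
continuous curves joining them. -/
def IsLengthSpace (X : Type*) [PseudoEMetricSpace X] : Prop :=
  ∀ x y : X, edist x y =
    ⨅ (γ : ℝ → X) (_ : ContinuousOn γ (Icc 0 1) ∧ γ 0 = x ∧ γ 1 = y),
      eVariationOn γ (Icc 0 1)

/-- The covering map preserves lengths of curves, i.e. the metric upstairs is the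
lifted length metric. -/
def IsLiftedMetric {X Xt : Type*} [PseudoEMetricSpace X] [PseudoEMetricSpace Xt]
    (ρ : Xt → X) : Prop :=
  ∀ γ : ℝ → Xt, ContinuousOn γ (Icc 0 1) →
    eVariationOn (ρ ∘ γ) (Icc 0 1) = eVariationOn γ (Icc 0 1)


/-- Almost-minimizing curves exist in a length space. -/
lemma exists_curve_lt {Y : Type*} [MetricSpace Y] (hY : IsLengthSpace Y) {p q : Y} {c : ℝ}
    (h : dist p q < c) :
    ∃ γ : ℝ → Y, ContinuousOn γ (Icc 0 1) ∧ γ 0 = p ∧ γ 1 = q ∧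
      eVariationOn γ (Icc 0 1) < ENNReal.ofReal c := by
  have h1 : edist p q < ENNReal.ofReal c := by
    rw [edist_dist]
    exact (ENNReal.ofReal_lt_ofReal_iff (lt_of_le_of_lt dist_nonneg h)).2 h
  rw [hY p q, iInf_lt_iff] at h1
  obtain ⟨γ, hγ⟩ := h1
  rw [iInf_lt_iff] at hγ
  obtain ⟨⟨h1, h2, h3⟩, h4⟩ := hγ
  exact ⟨γ, h1, h2, h3, h4⟩

lemma curve_dist_lt {Y : Type*} [MetricSpace Y] {γ : ℝ → Y} {c : ℝ}
    (h : eVariationOn γ (Icc 0 1) < ENNReal.ofReal c) {s t : ℝ} (hs : s ∈ Icc (0 : ℝ) 1)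
    (ht : t ∈ Icc (0 : ℝ) 1) : dist (γ s) (γ t) < c := by
  have h1 := lt_of_le_of_lt (eVariationOn.edist_le γ hs ht) h
  rw [edist_dist] at h1
  exact (ENNReal.ofReal_lt_ofReal_iff_of_nonneg dist_nonneg).1 h1

/-- Approximate intermediate points. -/
lemma exists_between_le {Y : Type*} [MetricSpace Y] (hY : IsLengthSpace Y) {p q : Y} {a b : ℝ}
    (ha : 0 ≤ a) (hb : 0 ≤ b) (h : dist p q < a + b) :
    ∃ m, dist p m ≤ a ∧ dist m q ≤ b := by
  by_cases hpq : dist p q ≤ a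
  · exact ⟨q, hpq, by simpa using hb⟩
  push Not at hpq
  obtain ⟨γ, hc, h0, h1, hv⟩ := exists_curve_lt hY h
  have hcd : ContinuousOn (fun t => dist p (γ t)) (Icc 0 1) :=
    (continuous_const.dist continuous_id).comp_continuousOn hc
  obtain ⟨t, ht, hta⟩ : a ∈ (fun t => dist p (γ t)) '' Icc 0 1 := by
    apply intermediate_value_Icc zero_le_one hcd
    simp only [h0, h1, dist_self]
    exact ⟨ha, hpq.le⟩
  refine ⟨γ t, hta.le, ?_⟩
  have hadd := eVariationOn.Icc_add_Icc γ (s := univ) ht.1 ht.2 (mem_univ t)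
  simp only [univ_inter] at hadd
  have e1 := eVariationOn.edist_le γ (s := Icc 0 t) ⟨le_rfl, ht.1⟩ ⟨ht.1, le_rfl⟩
  have e2 := eVariationOn.edist_le γ (s := Icc t 1) ⟨le_rfl, ht.2⟩ ⟨ht.2, le_rfl⟩
  have e3 := add_le_add e1 e2
  rw [hadd, h0, h1, edist_dist, edist_dist, ← ENNReal.ofReal_add dist_nonneg dist_nonneg] at e3
  have e4 := (ENNReal.ofReal_lt_ofReal_iff_of_nonneg
    (add_nonneg dist_nonneg dist_nonneg)).1 (lt_of_le_of_lt e3 hv)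
  simp only at hta
  linarith

lemma exists_between_lt {Y : Type*} [MetricSpace Y] (hY : IsLengthSpace Y) {p q : Y} {a b : ℝ}
    (ha : 0 < a) (hb : 0 < b) (h : dist p q < a + b) :
    ∃ m, dist p m < a ∧ dist m q < b := by
  obtain ⟨δ, hδ, h1⟩ : ∃ δ > 0, δ < a ∧ δ < b ∧ 2 * δ < a + b - dist p q := by
    refine ⟨min (min a b) (a + b - dist p q) / 3, ?_, ?_, ?_, ?_⟩
    · have : 0 < min (min a b) (a + b - dist p q) := lt_min (lt_min ha hb) (by linarith)
      linarith
    all_goals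
      have h1 := min_le_left (min a b) (a + b - dist p q)
      have h2 := min_le_right (min a b) (a + b - dist p q)
      have h3 := min_le_left a b
      have h4 := min_le_right a b
      linarith
  obtain ⟨m, hm1, hm2⟩ := exists_between_le hY (p := p) (q := q) (a := a - δ) (b := b - δ)
    (by linarith) (by linarith) (by linarith)
  exact ⟨m, by linarith, by linarith⟩

/-- Approximate subdivision of a minimizing curve. -/
lemma exists_chain {Y : Type*} [MetricSpace Y] (hY : IsLengthSpace Y) {c : ℝ} (hc : 0 < c)
    (p : Y) (k : ℕ) : ∀ q : Y, dist p q < (k + 1 : ℕ) * c →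
    ∃ y : ℕ → Y, y 0 = p ∧ y (k + 1) = q ∧ ∀ i ≤ k, dist (y i) (y (i + 1)) ≤ c := by
  induction k with
  | zero =>
    intro q hq
    refine ⟨fun i => if i = 0 then p else q, by simp, by simp, ?_⟩
    intro i hi
    obtain rfl : i = 0 := by omega
    simp at hq ⊢
    exact hq.le
  | succ k ih =>
    intro q hq
    obtain ⟨m, hm1, hm2⟩ := exists_between_lt hY (p := p) (q := q) (a := (k + 1 : ℕ) * c) (b := c)
      (by positivity) hc (by push_cast at hq ⊢; linarith)
    obtain ⟨y, hy0, hy1, hy⟩ := ih m hm1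
    refine ⟨fun i => if i ≤ k + 1 then y i else q, by simp [hy0], by simp, ?_⟩
    intro i hi
    rcases Nat.lt_or_ge i (k + 1) with h | h
    · have h' : i ≤ k := by omega
      simp [hi, h', hy i h']
    · obtain rfl : i = k + 1 := by omega
      simp [hy1, hm2.le]

/-- Monodromy along an almost minimizing curve. -/
lemma exists_monodromy {X Xt : Type*} [MetricSpace X] [MetricSpace Xt]
    (hX : IsLengthSpace X) {ρ : Xt → X} (hρ : IsCoveringMap ρ) (hlift : IsLiftedMetric ρ)
    {a b : X} {c : ℝ} (h : dist a b < c) :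
    ∃ f : Xt → Xt, (∀ z, ρ z = a → ρ (f z) = b ∧ dist z (f z) ≤ c) ∧
      ∀ z w, ρ z = a → ρ w = a → f z = f w → z = w := by
  obtain ⟨γ, hc, h0, h1, hv⟩ := exists_curve_lt hX h
  let g : C(unitInterval, X) := ⟨fun t => γ t, continuousOn_iff_continuous_domRestrict.1 hc⟩
  have hg0 : g 0 = a := h0
  have hg1 : g 1 = b := h1
  have key : ∀ z, ∃ Γ : C(unitInterval, Xt), ρ z = a → (ρ ∘ Γ = g ∧ Γ 0 = z) := by
    intro z
    by_cases hz : ρ z = a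
    · exact ⟨hρ.liftPath g z (hg0.trans hz.symm), fun _ =>
        ⟨hρ.liftPath_lifts _ _ _, hρ.liftPath_zero _ _ _⟩⟩
    · exact ⟨.const _ z, fun h => (hz h).elim⟩
  choose Γ hΓ using key
  refine ⟨fun z => Γ z 1, ?_, ?_⟩
  · intro z hz
    obtain ⟨hl, hz0⟩ := hΓ z hz
    refine ⟨by rw [← hg1, ← hl]; rfl, ?_⟩
    let G : ℝ → Xt := IccExtend (zero_le_one' ℝ) (Γ z)
    have hG : Continuous G := (Γ z).continuous.Icc_extend'
    have hvar : eVariationOn G (Icc 0 1) = eVariationOn γ (Icc 0 1) := by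
      rw [← hlift G hG.continuousOn]
      apply eVariationOn.congr
      intro t ht
      simp only [G, Function.comp, IccExtend_of_mem _ _ ht]
      exact congrFun hl ⟨t, ht⟩
    have := curve_dist_lt (hvar.trans_lt hv) (s := 0) (t := 1) (by simp) (by simp)
    have e0 : G 0 = z := by
      simp only [G]
      rw [IccExtend_left]
      exact hz0
    have e1 : G 1 = Γ z 1 := by
      simp only [G]
      rw [IccExtend_right]
      rfl
    rw [e0, e1] at this
    exact this.le
  · intro z w hz hw hzw
    have := hρ.eq_of_comp_eq (Γ z).continuous (Γ w).continuous
      ((hΓ z hz).1.trans (hΓ w hw).1.symm) 1 hzw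
    rw [← (hΓ z hz).2, ← (hΓ w hw).2, this]

lemma proj_dist_le {X Xt : Type*} [MetricSpace X] [MetricSpace Xt]
    (hXt : IsLengthSpace Xt) {ρ : Xt → X} (hlift : IsLiftedMetric ρ) (y z : Xt) :
    dist (ρ y) (ρ z) ≤ dist y z := by
  apply le_of_forall_gt
  intro c hc
  obtain ⟨γ, h, h0, h1, hv⟩ := exists_curve_lt hXt hc
  rw [← hlift γ h] at hv
  have := curve_dist_lt hv (s := 0) (t := 1) (by simp) (by simp)
  simpa [h0, h1] using this

/-- Uniform local compactness of the cover. -/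
lemma exists_compact_radius {X Xt : Type*} [MetricSpace X] [MetricSpace Xt]
    [CompactSpace X] (hXt : IsLengthSpace Xt)
    {ρ : Xt → X} (hρ : IsCoveringMap ρ) (hlift : IsLiftedMetric ρ) :
    ∃ ε > 0, ∀ y : Xt, IsCompact (Metric.closedBall y ε) := by
  choose hdisc U hxU hU hfU H hH using hρ
  obtain ⟨δ, hδ, hL⟩ := lebesgue_number_lemma_of_metric (isCompact_univ (X := X)) hU
    (fun x _ => mem_iUnion.2 ⟨x, hxU x⟩)
  refine ⟨δ / 2, by positivity, fun y => ?_⟩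
  obtain ⟨x, hx⟩ := hL (ρ y) (mem_univ _)
  have hyU : y ∈ ρ ⁻¹' U x := hx (Metric.mem_ball_self hδ)
  have hball : ∀ z, dist y z < δ → z ∈ ρ ⁻¹' U x := fun z hz =>
    hx (by rw [Metric.mem_ball']; exact (proj_dist_le hXt hlift y z).trans_lt hz)
  have hsheet : ∀ z (hz : dist y z < δ), (H x ⟨z, hball z hz⟩).2 = (H x ⟨y, hyU⟩).2 := by
    intro z hz
    obtain ⟨γ, h, h0, h1, hv⟩ := exists_curve_lt hXt hz
    have hin : ∀ t : unitInterval, dist y (γ t) < δ := fun t => by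
      have := curve_dist_lt hv (s := 0) (t := t) (by simp) t.2
      rwa [h0] at this
    let g : unitInterval → ρ ⁻¹' U x := fun t => ⟨γ t, hball _ (hin t)⟩
    have hg : Continuous g := (continuousOn_iff_continuous_domRestrict.1 h).subtype_mk _
    have := hdisc x
    have hconst := PreconnectedSpace.constant (α := unitInterval) inferInstance
      (f := fun t => (H x (g t)).2) (continuous_snd.comp ((H x).continuous.comp hg))
      (x := 1) (y := 0)
    have e0 : g 0 = ⟨y, hyU⟩ := Subtype.ext h0
    have e1 : g 1 = ⟨z, hball z hz⟩ := Subtype.ext h1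
    simpa only [e0, e1] using hconst
  let K : Set (U x) := Subtype.val ⁻¹' Metric.closedBall (ρ y) (δ / 2)
  have hKsub : Metric.closedBall (ρ y) (δ / 2) ⊆ U x :=
    (Metric.closedBall_subset_ball (by linarith)).trans hx
  have hK : IsCompact K := by
    rw [Subtype.isCompact_iff, Subtype.image_preimage_coe, inter_eq_right.2 hKsub]
    exact Metric.isClosed_closedBall.isCompact
  let s : U x → Xt := fun u => ((H x).symm (u, (H x ⟨y, hyU⟩).2) : ρ ⁻¹' U x)
  have hs : Continuous s := by fun_prop
  refine (hK.image hs).of_isClosed_subset Metric.isClosed_closedBall ?_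
  intro z hz
  have hz' : dist y z ≤ δ / 2 := Metric.mem_closedBall'.1 hz
  have hzδ : dist y z < δ := by linarith
  refine ⟨⟨ρ z, hball z hzδ⟩, ?_, ?_⟩
  · exact Metric.mem_closedBall'.2 ((proj_dist_le hXt hlift y z).trans hz')
  · have : (H x).symm (⟨ρ z, hball z hzδ⟩, (H x ⟨y, hyU⟩).2) = ⟨z, hball z hzδ⟩ := by
      rw [Homeomorph.symm_apply_eq]
      refine Prod.ext (Subtype.ext ?_) ?_
      · rw [hH]
      · exact (hsheet z hzδ).symm
    simp only [s, this]

/-- Hopf-Rinow: closed balls are compact. -/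
lemma isCompact_closedBall_of_uniform {Y : Type*} [MetricSpace Y] (hY : IsLengthSpace Y) {ε : ℝ}
    (hε : 0 < ε) (h : ∀ y : Y, IsCompact (Metric.closedBall y ε)) (p : Y) (k : ℕ) :
    IsCompact (Metric.closedBall p (k * (ε / 4))) := by
  induction k with
  | zero => simp
  | succ k ih =>
    obtain ⟨t, -, htf, ht⟩ := ih.finite_cover_balls (e := ε / 2) (by positivity)
    refine (htf.isCompact_biUnion (fun y _ => h y)).of_isClosed_subset
      Metric.isClosed_closedBall ?_
    intro z hz
    rw [Metric.mem_closedBall'] at hz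
    push_cast at hz
    obtain ⟨m, hm1, hm2⟩ := exists_between_le hY (p := p) (q := z) (a := k * (ε / 4)) (b := ε / 2)
      (by positivity) (by positivity) (by linarith)
    obtain ⟨y, hy, hmy⟩ := mem_iUnion₂.1 (ht (Metric.mem_closedBall'.2 hm1))
    refine mem_iUnion₂.2 ⟨y, hy, ?_⟩
    rw [Metric.mem_ball'] at hmy
    rw [Metric.mem_closedBall']
    linarith [dist_triangle y m z]

/-- A bounded covering has finite fibres. -/
lemma finite_fiber_of_bounded {X Xt : Type*} [MetricSpace X] [MetricSpace Xt]
    [CompactSpace X] (hXt : IsLengthSpace Xt)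
    {ρ : Xt → X} (hρ : IsCoveringMap ρ) (hlift : IsLiftedMetric ρ)
    (hb : Bornology.IsBounded (univ : Set Xt)) (p : Xt) : Finite (ρ ⁻¹' {ρ p}) := by
  obtain ⟨ε, hε, h⟩ := exists_compact_radius hXt hρ hlift
  obtain ⟨R, hR⟩ := hb.subset_closedBall p
  obtain ⟨k, hk⟩ := exists_nat_ge (R / (ε / 4))
  rw [div_le_iff₀ (by positivity)] at hk
  have hc : IsCompact (ρ ⁻¹' {ρ p}) :=
    (isCompact_closedBall_of_uniform hXt hε h p k).of_isClosed_subset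
      (isClosed_singleton.preimage hρ.continuous)
      ((subset_univ _).trans (hR.trans (Metric.closedBall_subset_closedBall hk)))
  have := (hρ (ρ p)).discreteTopology_fiber
  have := isCompact_iff_compactSpace.1 hc
  exact finite_of_compact_of_discrete

lemma dist_le_of_finite_fiber {X Xt : Type*} [MetricSpace X] [MetricSpace Xt]
    [CompactSpace X] (hX : IsLengthSpace X) (hXt : IsLengthSpace Xt)
    (ρ : Xt → X) (hρ : IsCoveringMap ρ) (hlift : IsLiftedMetric ρ)
    (n : ℕ) (hn0 : 0 < n) (hn : ∀ x : X, Nat.card (ρ ⁻¹' {x}) = n) (p q : Xt) :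
    dist p q ≤ n * Metric.diam (univ : Set X) := by
  by_contra hcon
  push Not at hcon
  set d := Metric.diam (univ : Set X) with hd
  have hd0 : 0 ≤ d := Metric.diam_nonneg
  have hdist : ∀ a b : X, dist a b ≤ d := fun a b =>
    Metric.dist_le_diam_of_mem isCompact_univ.isBounded (mem_univ a) (mem_univ b)
  obtain ⟨k, rfl⟩ : ∃ k, n = k + 1 := ⟨n - 1, by omega⟩
  set N : ℝ := ((k + 1 : ℕ) : ℝ) with hN
  have hN1 : 1 ≤ N := by rw [hN]; push_cast; linarith [(Nat.cast_nonneg k : (0 : ℝ) ≤ k)]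
  obtain ⟨η, hη, hLη⟩ : ∃ η > 0, dist p q = N * (d + η) := by
    refine ⟨dist p q / N - d, ?_, by field_simp; ring⟩
    rw [gt_iff_lt, sub_pos, lt_div_iff₀ (by linarith)]
    linarith
  obtain ⟨ε, hε, hεη⟩ : ∃ ε > 0, 2 * N * ε < η := by
    refine ⟨η / (2 * N + 1), by positivity, ?_⟩
    rw [← mul_div_assoc, div_lt_iff₀ (by positivity)]
    nlinarith
  obtain ⟨y, hy0, hy1, hy⟩ := exists_chain hXt (c := d + η + ε) (by positivity) p k q
    (by rw [hLη, ← hN]; nlinarith)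
  have hmon := fun i : ℕ => exists_monodromy hX hρ hlift (a := ρ (y i)) (b := ρ (y (i + 1)))
    (c := d + ε) (by linarith [hdist (ρ (y i)) (ρ (y (i + 1)))])
  choose m hm hinj using hmon
  -- `T i l` transports the fibre over `y i` to the fibre over `y (i + l)`
  let T : ℕ → ℕ → Xt → Xt := fun i l z => Nat.rec z (fun l w => m (i + l) w) l
  have hT : ∀ i l z, ρ z = ρ (y i) → ρ (T i l z) = ρ (y (i + l)) ∧
      dist z (T i l z) ≤ l * (d + ε) := by
    intro i l z hz
    induction l with
    | zero => simpa [T] using hz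
    | succ l ih =>
      have h1 := hm (i + l) (T i l z) ih.1
      refine ⟨h1.1, ?_⟩
      have h2 := dist_triangle z (T i l z) (T i (l + 1) z)
      have h3 : dist (T i l z) (T i (l + 1) z) ≤ d + ε := h1.2
      push_cast
      linarith [ih.2]
  have hTinj : ∀ i l z w, ρ z = ρ (y i) → ρ w = ρ (y i) → T i l z = T i l w → z = w := by
    intro i l z w hz hw
    induction l with
    | zero => exact id
    | succ l ih =>
      exact fun h => ih (hinj (i + l) _ _ (hT i l z hz).1 (hT i l w hw).1 h)
  have hTadd : ∀ i l l' z, T i (l + l') z = T (i + l) l' (T i l z) := by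
    intro i l l' z
    induction l' with
    | zero => rfl
    | succ l' ih =>
      change m (i + (l + l')) (T i (l + l') z) = m (i + l + l') (T (i + l) l' (T i l z))
      rw [ih, add_assoc]
  -- distance bounds along the chain
  have hch : ∀ i l, i + l ≤ k + 1 → dist (y i) (y (i + l)) ≤ l * (d + η + ε) := by
    intro i l
    induction l with
    | zero => simp
    | succ l ih =>
      intro h
      have h1 := ih (by omega)
      have h2 := hy (i + l) (by omega)
      have h3 := dist_triangle (y i) (y (i + l)) (y (i + (l + 1)))
      rw [← add_assoc] at h3 ⊢
      push_cast
      linarith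
  -- pigeonhole
  have hfin : Finite (ρ ⁻¹' {ρ (y (k + 1))}) :=
    Nat.finite_of_card_ne_zero (by rw [hn]; omega)
  have hcard := hn (ρ (y (k + 1)))
  let F : Fin (k + 2) → ρ ⁻¹' {ρ (y (k + 1))} := fun i =>
    ⟨T i (k + 1 - i) (y i), by
      have := (hT i (k + 1 - i) (y i) rfl).1
      rwa [show (i : ℕ) + (k + 1 - i) = k + 1 by omega] at this⟩
  have hF : ¬ Function.Injective F := by
    intro hF
    have := Nat.card_le_card_of_injective F hF
    simp [hcard] at this
  have main : ∀ i j : Fin (k + 2), i < j → F i = F j → False := by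
    intro i j hij hFij
    obtain ⟨l, hl⟩ : ∃ l, (j : ℕ) = i + l := ⟨j - i, by omega⟩
    have hl1 : 1 ≤ l := by omega
    have hj := j.2
    have h1 : T i (k + 1 - i) (y i) = T j (k + 1 - j) (y j) := congrArg Subtype.val hFij
    rw [show k + 1 - (i : ℕ) = l + (k + 1 - j) by omega, hTadd, ← hl] at h1
    have h2 := hT i l (y i) rfl
    rw [← hl] at h2
    have h3 := hTinj j _ _ _ h2.1 rfl h1
    have h4 := h2.2
    rw [h3] at h4
    have h5 := hch 0 i (by omega)
    have h6 := hch j (k + 1 - j) (by omega)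
    rw [show (j : ℕ) + (k + 1 - j) = k + 1 by omega, hy1] at h6
    rw [zero_add, hy0] at h5
    have h7 := dist_triangle4 p (y i) (y j) q
    have hsum : ((i : ℕ) : ℝ) + l + ((k + 1 - j : ℕ) : ℝ) = N := by
      rw [hN]
      norm_cast
      omega
    have hl1' : (1 : ℝ) ≤ l := by exact_mod_cast hl1
    have e1 : dist p q ≤ N * (d + ε) + (N - l) * η := by
      rw [← hsum]
      nlinarith
    rw [hLη] at e1
    nlinarith
  apply hF
  intro i j hij
  rcases lt_trichotomy i j with h | h | h
  · exact (main i j h hij).elim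
  · exact h
  · exact (main j i h hij.symm).elim

/-- An `n`-fold covering space of a compact length space, with the lifted metric,
has diameter at most `n` times the diameter of the base. -/
theorem diam_nfold_cover_le {X Xt : Type*} [MetricSpace X] [MetricSpace Xt]
    [CompactSpace X] (hX : IsLengthSpace X) (hXt : IsLengthSpace Xt)
    (ρ : Xt → X) (hρ : IsCoveringMap ρ) (hlift : IsLiftedMetric ρ)
    (n : ℕ) (hn : ∀ x : X, Nat.card (ρ ⁻¹' {x}) = n) :
    Metric.diam (univ : Set Xt) ≤ n * Metric.diam (univ : Set X) := by

  rcases Nat.eq_zero_or_pos n with rfl | hn0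
  · have : Metric.diam (univ : Set Xt) = 0 := by
      by_cases hb : Bornology.IsBounded (univ : Set Xt)
      · rcases isEmpty_or_nonempty Xt with he | ⟨⟨p⟩⟩
        · rw [univ_eq_empty_iff.2 he, Metric.diam_empty]
        · have hfin := finite_fiber_of_bounded hXt hρ hlift hb p
          have : Nonempty (ρ ⁻¹' {ρ p}) := ⟨⟨p, rfl⟩⟩
          exact absurd (hn (ρ p)) Nat.card_pos.ne'
      · exact Metric.diam_eq_zero_of_unbounded hb
    rw [this]
    simp
  · exact Metric.diam_le_of_forall_dist_le (mul_nonneg (Nat.cast_nonneg n) Metric.diam_nonneg)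
      fun p _ q _ => dist_le_of_finite_fiber hX hXt ρ hρ hlift n hn0 hn p q
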